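/- The limit superior, as n → ∞, of log₂(u_Opt(n,0)) / n equals log₂(5/4). -/

import Mathlib

namespace TQ

/-- A decision tree: internal nodes are labeled by questions (subsets of `α`,
with the two children corresponding to Yes/No), leaves by elements of `α`. -/
inductive DTree (α : Type) where
  | leaf (x : α) : DTree α
  | node (q : Finset α) (yes no : DTree α) : DTree α

namespace DTree

variable {α : Type} [DecidableEq α]

/-- The list of leaf labels of a decision tree. -/
def leaves : DTree α → List α
  | .leaf x => [x]
  | .node _ t f => leaves t ++ leaves f

/-- The set of questions appearing at internal nodes. -/
def questions : DTree α → Set (Finset α)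
  | .leaf _ => ∅
  | .node q t f => insert q (questions t ∪ questions f)

/-- Follow the path of `x` (Yes-edge iff `x` belongs to the question);
returns `some d` iff the path ends at a leaf labeled `x`, at depth `d`. -/
def find? : DTree α → α → Option ℕ
  | .leaf y, x => if y = x then some 0 else none
  | .node q t f, x => (if x ∈ q then find? t x else find? f x).map (· + 1)

/-- The depth of the leaf labeled `x` (junk value `0` if the path of `x`
does not end at a leaf labeled `x`). -/
def depth (T : DTree α) (x : α) : ℕ := (T.find? x).getD 0

end DTree

variable {α : Type} [Fintype α] [DecidableEq α]

/-- `μ` is a probability distribution on `α`. -/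
def IsDistribution (μ : α → ℝ) : Prop := (∀ x, 0 ≤ μ x) ∧ ∑ x, μ x = 1

/-- `T` is valid for `μ`: its leaves are distinct, the set of leaf labels is the
support of `μ`, and for every `x` in the support the path of `x` ends at the
leaf labeled `x`. -/
structure IsValid (T : DTree α) (μ : α → ℝ) : Prop where
  nodup : T.leaves.Nodup
  mem_leaves : ∀ x, x ∈ T.leaves ↔ μ x ≠ 0
  finds : ∀ x, μ x ≠ 0 → T.find? x = some (T.depth x)

/-- The cost of `T` on `μ`: the average depth `∑ x, μ(x) · T(x)`. -/
noncomputable def cost (T : DTree α) (μ : α → ℝ) : ℝ := ∑ x, μ x * (T.depth x : ℝ)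

/-- All questions of `T` belong to `Q`. -/
def UsesQuestions (T : DTree α) (Q : Set (Finset α)) : Prop := T.questions ⊆ Q

/-- `Opt(μ)`: the optimal cost over all decision trees valid for `μ`. -/
noncomputable def OptCost (μ : α → ℝ) : ℝ :=
  sInf { c | ∃ T : DTree α, IsValid T μ ∧ c = cost T μ }

/-- `c_Q(μ)`: the optimal cost over decision trees valid for `μ`
using only questions from `Q`. -/
noncomputable def cQ (Q : Set (Finset α)) (μ : α → ℝ) : ℝ :=
  sInf { c | ∃ T : DTree α, IsValid T μ ∧ UsesQuestions T Q ∧ c = cost T μ }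

/-- The base-2 (Shannon) entropy of `μ`. (Note `Real.logb 2 0 = 0`.) -/
noncomputable def entropy (μ : α → ℝ) : ℝ := ∑ x, -(μ x * Real.logb 2 (μ x))

/-- `Q` achieves prolixity `r`: for every distribution there is a valid tree using
only questions from `Q` of cost at most `Opt(μ) + r`. -/
def AchievesProlixity {n : ℕ} (Q : Finset (Finset (Fin n))) (r : ℝ) : Prop :=
  ∀ μ : Fin n → ℝ, IsDistribution μ →
    ∃ T : DTree (Fin n), IsValid T μ ∧ UsesQuestions T ↑Q ∧ cost T μ ≤ OptCost μ + r

/-- `Q` achieves redundancy `r`: for every distribution there is a valid tree using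
only questions from `Q` of cost at most `H(μ) + r`. -/
def AchievesRedundancy {n : ℕ} (Q : Finset (Finset (Fin n))) (r : ℝ) : Prop :=
  ∀ μ : Fin n → ℝ, IsDistribution μ →
    ∃ T : DTree (Fin n), IsValid T μ ∧ UsesQuestions T ↑Q ∧ cost T μ ≤ entropy μ + r

/-- `u_Opt(n,r)`: the minimum cardinality of a set of questions achieving prolixity `r`. -/
noncomputable def uOpt (n : ℕ) (r : ℝ) : ℕ :=
  sInf { k | ∃ Q : Finset (Finset (Fin n)), Q.card = k ∧ AchievesProlixity Q r }

/-- `u_H(n,r)`: the minimum cardinality of a set of questions achieving redundancy `r`. -/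
noncomputable def uH (n : ℕ) (r : ℝ) : ℕ :=
  sInf { k | ∃ Q : Finset (Finset (Fin n)), Q.card = k ∧ AchievesRedundancy Q r }

end TQ

namespace TQ
open Finset

section trees
variable {α : Type} [DecidableEq α]

lemma find_mem (T : DTree α) (x : α) (k : ℕ) (h : T.find? x = some k) : x ∈ T.leaves := by
  induction T generalizing k with
  | leaf y =>
    simp only [DTree.find?] at h
    split_ifs at h with h1
    simp [DTree.leaves, h1]
  | node q t f iht ihf =>
    simp only [DTree.find?, Option.map_eq_some_iff] at h
    obtain ⟨a, ha, -⟩ := h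
    simp only [DTree.leaves, List.mem_append]
    split_ifs at ha with h1
    · exact Or.inl (iht _ ha)
    · exact Or.inr (ihf _ ha)

lemma find_lt (T : DTree α) (x : α) (k : ℕ) (h : T.find? x = some k) : k < T.leaves.length := by
  induction T generalizing k with
  | leaf y =>
    simp only [DTree.find?] at h
    split_ifs at h with h1
    simp_all [DTree.leaves]
  | node q t f iht ihf =>
    simp only [DTree.find?, Option.map_eq_some_iff] at h
    obtain ⟨a, ha, rfl⟩ := h
    have hl : ∀ S : DTree α, 0 < S.leaves.length := by
      intro S
      induction S with
      | leaf y => simp [DTree.leaves]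
      | node q t f iht ihf => simp only [DTree.leaves, List.length_append]; omega
    have h2 := hl t
    have h3 := hl f
    simp only [DTree.leaves, List.length_append]
    split_ifs at ha with h1
    · have := iht _ ha; omega
    · have := ihf _ ha; omega

lemma node_split (q : Finset α) (t f : DTree α) (d : α → ℕ)
    (hn : (DTree.node q t f).leaves.Nodup)
    (hf : ∀ x ∈ (DTree.node q t f).leaves, (DTree.node q t f).find? x = some (d x)) :
    (∀ x ∈ t.leaves, x ∈ q ∧ 1 ≤ d x ∧ t.find? x = some (d x - 1)) ∧
    (∀ x ∈ f.leaves, x ∉ q ∧ 1 ≤ d x ∧ f.find? x = some (d x - 1)) := by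
  simp only [DTree.leaves, List.nodup_append, List.mem_append] at hn hf
  obtain ⟨h1, h2, h3⟩ := hn
  constructor
  · intro x hx
    have := hf x (Or.inl hx)
    simp only [DTree.find?, Option.map_eq_some_iff] at this
    obtain ⟨a, ha, hb⟩ := this
    split_ifs at ha with hq
    · refine ⟨hq, by omega, ?_⟩
      rw [ha, ← hb]; simp
    · exact absurd rfl (h3 x hx x (find_mem _ _ _ ha))
  · intro x hx
    have := hf x (Or.inr hx)
    simp only [DTree.find?, Option.map_eq_some_iff] at this
    obtain ⟨a, ha, hb⟩ := this
    split_ifs at ha with hq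
    · exact absurd rfl (h3 x (find_mem _ _ _ ha) x hx)
    · refine ⟨hq, by omega, ?_⟩
      rw [ha, ← hb]; simp

lemma sum_shift (Y : Finset α) (d : α → ℕ) (h : ∀ x ∈ Y, 1 ≤ d x) :
    ∑ x ∈ Y, (1/2 : ℝ) ^ (d x) = 1/2 * ∑ x ∈ Y, (1/2 : ℝ) ^ (d x - 1) := by
  rw [mul_sum]
  refine sum_congr rfl fun x hx => ?_
  rw [← pow_succ', Nat.sub_add_cancel (h x hx)]

lemma kraft (T : DTree α) (d : α → ℕ) (hn : T.leaves.Nodup)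
    (hf : ∀ x ∈ T.leaves, T.find? x = some (d x)) :
    ∑ x ∈ T.leaves.toFinset, (1/2 : ℝ) ^ (d x) = 1 := by
  induction T generalizing d with
  | leaf y =>
    have := hf y (by simp [DTree.leaves])
    simp [DTree.find?] at this
    simp [DTree.leaves, ← this]
  | node q t f iht ihf =>
    obtain ⟨h1, h2⟩ := node_split q t f d hn hf
    simp only [DTree.leaves, List.nodup_append] at hn
    rw [DTree.leaves, List.toFinset_append, sum_union, sum_shift _ d, sum_shift f.leaves.toFinset d,
      iht _ hn.1, ihf _ hn.2.1]
    · norm_num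
    · exact fun x hx => (h2 x hx).2.2
    · exact fun x hx => (h1 x hx).2.2
    · exact fun x hx => (h2 x (by simpa using hx)).2.1
    · exact fun x hx => (h1 x (by simpa using hx)).2.1
    · rw [Finset.disjoint_left]
      intro x hx hx'
      exact hn.2.2 x (by simpa using hx) x (by simpa using hx') rfl

lemma node_half (q : Finset α) (t f : DTree α) (d : α → ℕ)
    (hn : (DTree.node q t f).leaves.Nodup)
    (hf : ∀ x ∈ (DTree.node q t f).leaves, (DTree.node q t f).find? x = some (d x)) :
    ∑ x ∈ (DTree.node q t f).leaves.toFinset with x ∈ q, (1/2 : ℝ) ^ (d x) = 1/2 := by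
  obtain ⟨h1, h2⟩ := node_split q t f d hn hf
  have : ((DTree.node q t f).leaves.toFinset.filter (· ∈ q)) = t.leaves.toFinset := by
    ext x
    simp only [DTree.leaves, mem_filter, List.mem_toFinset, List.mem_append]
    constructor
    · rintro ⟨h | h, hq⟩
      · exact h
      · exact absurd hq (h2 x h).1
    · exact fun h => ⟨Or.inl h, (h1 x h).1⟩
  simp only [DTree.leaves, List.nodup_append] at hn
  rw [this, sum_shift _ d, kraft t _ hn.1]
  · norm_num
  · exact fun x hx => (h1 x hx).2.2
  · exact fun x hx => (h1 x (by simpa using hx)).2.1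

lemma one_le_of_sum (Y : Finset α) (d : α → ℕ) (hY : 2 ≤ Y.card)
    (hs : ∑ x ∈ Y, (1/2 : ℝ) ^ (d x) = 1) : ∀ x ∈ Y, 1 ≤ d x := by
  intro x hx
  by_contra h
  have h0 : d x = 0 := by omega
  rw [← add_sum_erase _ _ hx, h0] at hs
  have hc := card_erase_of_mem hx
  have : 0 < ∑ y ∈ Y.erase x, (1/2 : ℝ) ^ (d y) := by
    apply sum_pos (fun _ _ => by positivity)
    rw [← card_pos]; omega
  norm_num at hs
  norm_num at this
  linarith

lemma build (Q : Set (Finset α))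
    (hQ : ∀ (Y : Finset α) (d : α → ℕ), 2 ≤ Y.card → ∑ x ∈ Y, (1/2 : ℝ) ^ (d x) = 1 →
      ∃ A ∈ Q, ∑ x ∈ Y with x ∈ A, (1/2 : ℝ) ^ (d x) = 1/2) (N : ℕ) :
    ∀ (Y : Finset α) (d : α → ℕ), Y.card ≤ N → ∑ x ∈ Y, (1/2 : ℝ) ^ (d x) = 1 →
      ∃ T : DTree α, T.questions ⊆ Q ∧ T.leaves.Nodup ∧ (∀ x, x ∈ T.leaves ↔ x ∈ Y) ∧
        ∀ x ∈ Y, T.find? x = some (d x) := by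
  induction N with
  | zero =>
    intro Y d hY hs
    have : Y = ∅ := by simpa using hY
    subst this; simp at hs
  | succ N ih =>
    intro Y d hY hs
    by_cases h2 : 2 ≤ Y.card
    · have hd := one_le_of_sum Y d h2 hs
      obtain ⟨A, hA, hA2⟩ := hQ Y d h2 hs
      have hsplit := sum_filter_add_sum_filter_not Y (· ∈ A) (fun x => (1/2 : ℝ) ^ (d x))
      have hA3 : ∑ x ∈ Y with x ∉ A, (1/2 : ℝ) ^ (d x) = 1/2 := by linarith
      have hc := card_filter_add_card_filter_not (s := Y) (· ∈ A)
      have c1 : 0 < (Y.filter (· ∈ A)).card := by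
        rw [card_pos]; by_contra h; rw [not_nonempty_iff_eq_empty] at h; rw [h] at hA2; norm_num at hA2
      have c2 : 0 < (Y.filter (· ∉ A)).card := by
        rw [card_pos]; by_contra h; rw [not_nonempty_iff_eq_empty] at h; rw [h] at hA3; norm_num at hA3
      rw [sum_shift _ d (fun x hx => hd x (mem_filter.1 hx).1)] at hA2 hA3
      obtain ⟨t, t1, t2, t3, t4⟩ := ih (Y.filter (· ∈ A)) (fun x => d x - 1) (by omega) (by linarith)
      obtain ⟨f, f1, f2, f3, f4⟩ := ih (Y.filter (· ∉ A)) (fun x => d x - 1) (by omega) (by linarith)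
      refine ⟨.node A t f, ?_, ?_, ?_, ?_⟩
      · simp only [DTree.questions]
        exact Set.insert_subset hA (Set.union_subset t1 f1)
      · simp only [DTree.leaves, List.nodup_append]
        refine ⟨t2, f2, ?_⟩
        rintro a ha b hb rfl
        rw [t3] at ha; rw [f3] at hb
        simp at ha hb; tauto
      · intro x
        simp only [DTree.leaves, List.mem_append, t3, f3, mem_filter]
        tauto
      · intro x hx
        simp only [DTree.find?, Option.map_eq_some_iff]
        refine ⟨d x - 1, ?_, Nat.sub_add_cancel (hd x hx)⟩
        split_ifs with h
        · exact t4 x (by simp [hx, h])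
        · exact f4 x (by simp [hx, h])
    · have : Y.card = 1 := by
        have : Y.card ≠ 0 := by
          intro h; rw [card_eq_zero] at h; subst h; simp at hs
        omega
      obtain ⟨x, rfl⟩ := card_eq_one.1 this
      have h0 : d x = 0 := by
        rw [sum_singleton] at hs
        by_contra h
        have := pow_lt_one₀ (by norm_num : (0:ℝ) ≤ 1/2) (by norm_num) h
        linarith
      refine ⟨.leaf x, by simp [DTree.questions], by simp [DTree.leaves], by simp [DTree.leaves], ?_⟩
      intro y hy
      rw [mem_singleton] at hy; subst hy
      simp [DTree.find?, h0]

lemma half_subset (d : α → ℕ) (G : Finset α) : (∀ x ∈ G, 1 ≤ d x) →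
    1/2 ≤ ∑ x ∈ G, (1/2 : ℝ) ^ (d x) → ∃ S ⊆ G, ∑ x ∈ S, (1/2 : ℝ) ^ (d x) = 1/2 := by
  induction G using Finset.strongInduction with
  | H G ih =>
    intro hd hs
    rcases hs.eq_or_lt with h | h
    · exact ⟨G, Subset.rfl, h.symm⟩
    · have hne : G.Nonempty := by
        by_contra h'; rw [not_nonempty_iff_eq_empty] at h'; subst h'; norm_num at h
      obtain ⟨x, hx, hm⟩ := exists_max_image G d hne
      have key : 1/2 ≤ ∑ y ∈ G.erase x, (1/2 : ℝ) ^ (d y) := by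
        have e1 := add_sum_erase G (fun y => (1/2 : ℝ) ^ (d y)) hx
        have e2 : ∑ y ∈ G, (1/2 : ℝ) ^ (d y) = ((∑ y ∈ G, 2 ^ (d x - d y) : ℕ) : ℝ) * (1/2) ^ (d x) := by
          push_cast
          rw [sum_mul]
          refine sum_congr rfl fun y hy => ?_
          have := hm y hy
          obtain ⟨k, hk⟩ := Nat.exists_eq_add_of_le this
          rw [hk, Nat.add_sub_cancel_left, pow_add, mul_comm, mul_assoc, ← mul_pow]; norm_num
        set M := ∑ y ∈ G, 2 ^ (d x - d y)
        have hp : (0:ℝ) < (1/2) ^ (d x) := by positivity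
        have e3 : (1/2 : ℝ) = ((2 ^ (d x - 1) : ℕ) : ℝ) * (1/2) ^ (d x) := by
          obtain ⟨k, hk⟩ := Nat.exists_eq_add_of_le (hd x hx)
          rw [hk, Nat.add_sub_cancel_left, pow_add]; push_cast
          rw [mul_comm, mul_assoc, ← mul_pow]; norm_num
        have e4 : 2 ^ (d x - 1) < M := by
          rw [e2] at h
          nth_rw 1 [e3] at h
          exact_mod_cast lt_of_mul_lt_mul_right h hp.le
        have e5 : ((2 ^ (d x - 1) : ℕ) : ℝ) + 1 ≤ M := by exact_mod_cast e4
        have := mul_le_mul_of_nonneg_right e5 hp.le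
        rw [add_mul, ← e3, ← e2] at this
        linarith
      obtain ⟨S, hS, hS2⟩ := ih _ (erase_ssubset hx) (fun y hy => hd y (mem_of_mem_erase hy)) key
      exact ⟨S, hS.trans (erase_subset _ _), hS2⟩

lemma build_univ (Y : Finset α) (d : α → ℕ) (hs : ∑ x ∈ Y, (1/2 : ℝ) ^ (d x) = 1) :
    ∃ T : DTree α, T.leaves.Nodup ∧ (∀ x, x ∈ T.leaves ↔ x ∈ Y) ∧
        ∀ x ∈ Y, T.find? x = some (d x) := by
  obtain ⟨T, -, h⟩ := build (Set.univ : Set (Finset α)) (by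
    intro Y d hY hs
    obtain ⟨S, hS, h⟩ := half_subset d Y (one_le_of_sum Y d hY hs) (by rw [hs]; norm_num)
    refine ⟨S, trivial, ?_⟩
    rw [filter_mem_eq_inter, inter_eq_right.2 hS, h]) Y.card Y d le_rfl hs
  exact ⟨T, h⟩

lemma exists_dyadic (Y : Finset α) (hY : Y.Nonempty) :
    ∃ d : α → ℕ, ∑ x ∈ Y, (1/2 : ℝ) ^ (d x) = 1 := by
  induction hY using Finset.Nonempty.cons_induction with
  | singleton a => exact ⟨fun _ => 0, by simp⟩
  | cons a s ha hs ih =>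
    obtain ⟨d, hd⟩ := ih
    refine ⟨fun x => if x = a then 1 else d x + 1, ?_⟩
    rw [sum_cons]
    have : ∑ x ∈ s, (1/2 : ℝ) ^ (if x = a then 1 else d x + 1) = ∑ x ∈ s, 1/2 * (1/2 : ℝ) ^ (d x) := by
      refine sum_congr rfl fun x hx => ?_
      rw [if_neg (by rintro rfl; exact ha hx), pow_succ']
    rw [this, ← mul_sum, hd]; norm_num

variable [Fintype α]

lemma opt_attained (μ : α → ℝ) (hμ : IsDistribution μ) :
    ∃ T : DTree α, IsValid T μ ∧ cost T μ = OptCost μ := by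
  have hne : { c | ∃ T : DTree α, IsValid T μ ∧ c = cost T μ }.Nonempty := by
    have hY : (univ.filter (fun x => μ x ≠ 0)).Nonempty := by
      by_contra h
      rw [not_nonempty_iff_eq_empty, filter_eq_empty_iff] at h
      have := hμ.2
      rw [sum_eq_zero (fun x hx => by simpa using h hx)] at this
      norm_num at this
    obtain ⟨d, hd⟩ := exists_dyadic _ hY
    obtain ⟨T, h1, h2, h3⟩ := build_univ _ d hd
    refine ⟨_, T, ⟨h1, by simpa using h2, ?_⟩, rfl⟩
    intro x hx
    have := h3 x (by simpa using hx)
    simp [DTree.depth, this]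
  have hfin : { c | ∃ T : DTree α, IsValid T μ ∧ c = cost T μ }.Finite := by
    apply (Set.finite_range (fun g : α → Fin (Fintype.card α + 1) => ∑ x, μ x * ((g x : ℕ) : ℝ))).subset
    rintro c ⟨T, hT, rfl⟩
    refine ⟨fun x => if h : μ x ≠ 0 then ⟨T.depth x, ?_⟩ else 0, ?_⟩
    · have h1 := find_lt T x _ (hT.finds x h)
      have h2 : T.leaves.length ≤ Fintype.card α := hT.nodup.length_le_card
      omega
    · simp only [cost]
      refine sum_congr rfl fun x _ => ?_
      by_cases h : μ x = 0
      · simp [h]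
      · simp [h]
  obtain ⟨T, hT, h⟩ := hne.csInf_mem hfin
  exact ⟨T, hT, h.symm⟩

lemma opt_le (μ : α → ℝ) (hμ : IsDistribution μ) (T : DTree α) (hT : IsValid T μ) :
    OptCost μ ≤ cost T μ := by
  apply csInf_le
  · refine ⟨0, ?_⟩
    rintro c ⟨T, -, rfl⟩
    exact sum_nonneg fun x _ => mul_nonneg (hμ.1 x) (by positivity)
  · exact ⟨T, hT, rfl⟩

lemma hitter_achieves {n : ℕ} (Q : Finset (Finset (Fin n)))
    (hQ : ∀ (Y : Finset (Fin n)) (d : Fin n → ℕ), 2 ≤ Y.card → ∑ x ∈ Y, (1/2 : ℝ) ^ (d x) = 1 →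
      ∃ A ∈ Q, ∑ x ∈ Y with x ∈ A, (1/2 : ℝ) ^ (d x) = 1/2) : AchievesProlixity Q 0 := by
  intro μ hμ
  obtain ⟨T, hT, hc⟩ := opt_attained μ hμ
  have hk := kraft T T.depth hT.nodup (fun x hx => hT.finds x ((hT.mem_leaves x).1 hx))
  obtain ⟨T', h1, h2, h3, h4⟩ := build (↑Q) (by simpa using hQ) _ _ _ le_rfl hk
  have hdep : ∀ x, μ x ≠ 0 → T'.depth x = T.depth x := by
    intro x hx
    have := h4 x (by simpa [hT.mem_leaves] using hx)
    rw [DTree.depth, this]; rfl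
  refine ⟨T', ⟨h2, ?_, ?_⟩, h1, ?_⟩
  · intro x; rw [h3]; simp [hT.mem_leaves]
  · intro x hx
    rw [hdep x hx]
    exact h4 x (by simpa [hT.mem_leaves] using hx)
  · rw [add_zero, ← hc]
    apply le_of_eq
    refine sum_congr rfl fun x _ => ?_
    by_cases h : μ x = 0
    · simp [h]
    · rw [hdep x h]

end trees
end TQ

namespace TQ
open Finset

lemma pow_gap (k : ℤ) : (1:ℝ) - 3/4 * k + (if k = 0 then 0 else 1/4) ≤ (1/2 : ℝ) ^ k := by
  split_ifs with h
  · subst h; norm_num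
  · rcases lt_or_gt_of_ne h with h | h
    · obtain ⟨j, rfl⟩ : ∃ j : ℕ, k = -((j:ℤ) + 1) := ⟨(-k - 1).toNat, by omega⟩
      have : (1/2 : ℝ) ^ (-((j:ℤ) + 1)) = 2 ^ (j + 1) := by
        rw [zpow_neg]; norm_cast; simp
      rw [this]
      have hb := one_add_mul_le_pow (by norm_num : (-2:ℝ) ≤ 1) j
      rw [pow_succ]
      norm_num at hb ⊢
      have : (0:ℝ) ≤ j := by positivity
      linarith
    · by_cases h1 : k = 1
      · subst h1; norm_num
      · have : (2:ℝ) ≤ k := by exact_mod_cast (by omega : (2:ℤ) ≤ k)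
        have : (0:ℝ) < (1/2) ^ k := by positivity
        linarith

lemma gibbs {α : Type} [Fintype α] (d e : α → ℕ)
    (hd : ∑ x, (1/2 : ℝ) ^ (d x) = 1) (he : ∑ x, (1/2 : ℝ) ^ (e x) = 1)
    (hc : ∑ x, (1/2 : ℝ) ^ (d x) * (e x : ℝ) ≤ ∑ x, (1/2 : ℝ) ^ (d x) * (d x : ℝ)) :
    e = d := by
  have h1 : ∀ x, (1/2 : ℝ) ^ (d x) * (1 - 3/4 * ((e x : ℝ) - d x) +
      (if (e x : ℤ) - d x = 0 then 0 else 1/4)) ≤ (1/2 : ℝ) ^ (e x) := by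
    intro x
    have := mul_le_mul_of_nonneg_left (pow_gap ((e x : ℤ) - d x))
      (by positivity : (0:ℝ) ≤ (1/2) ^ (d x))
    have e2 : (1/2 : ℝ) ^ (d x) * (1/2) ^ ((e x : ℤ) - d x) = (1/2) ^ (e x) := by
      rw [← zpow_natCast, ← zpow_natCast, ← zpow_add₀ (by norm_num)]; congr 1; ring
    rw [e2] at this
    push_cast at this
    exact this
  have h2 := sum_le_sum (fun x (_ : x ∈ univ) => h1 x)
  have h3 : ∑ x, (1/2 : ℝ) ^ (d x) * (1 - 3/4 * ((e x : ℝ) - d x) +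
      (if (e x : ℤ) - d x = 0 then 0 else 1/4)) = ∑ x, (1/2 : ℝ) ^ (d x)
      - 3/4 * (∑ x, (1/2 : ℝ) ^ (d x) * (e x : ℝ) - ∑ x, (1/2 : ℝ) ^ (d x) * (d x : ℝ))
      + ∑ x, (1/2 : ℝ) ^ (d x) * (if (e x : ℤ) - d x = 0 then 0 else 1/4) := by
    rw [← sum_sub_distrib, mul_sum, ← sum_sub_distrib, ← sum_add_distrib]
    refine sum_congr rfl fun x _ => ?_
    ring
  rw [h3, hd, he] at h2
  have hnn : ∀ x ∈ (univ : Finset α), (0:ℝ) ≤ (1/2 : ℝ) ^ (d x) * (if (e x : ℤ) - d x = 0 then 0 else 1/4) := by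
    intro x _
    split_ifs <;> positivity
  have h4 : ∑ x, (1/2 : ℝ) ^ (d x) * (if (e x : ℤ) - d x = 0 then 0 else 1/4) = 0 :=
    le_antisymm (by linarith) (sum_nonneg hnn)
  rw [sum_eq_zero_iff_of_nonneg hnn] at h4
  funext x
  have := h4 x (mem_univ x)
  by_contra hne
  rw [if_neg (by omega)] at this
  have : (0:ℝ) < (1/2 : ℝ) ^ (d x) * (1/4) := by positivity
  linarith

lemma root_split {n : ℕ} (hn : 2 ≤ n) (Q : Finset (Finset (Fin n))) (hQ : AchievesProlixity Q 0)
    (d : Fin n → ℕ) (hd : ∑ x, (1/2 : ℝ) ^ (d x) = 1) :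
    ∃ A ∈ Q, ∑ x ∈ A, (1/2 : ℝ) ^ (d x) = 1/2 := by
  have hpos : ∀ x, (1/2 : ℝ) ^ (d x) ≠ 0 := fun x => by positivity
  have hμ : IsDistribution (fun x => (1/2 : ℝ) ^ (d x)) := ⟨fun x => by positivity, hd⟩
  obtain ⟨T, hT, hTQ, hc⟩ := hQ _ hμ
  obtain ⟨T0, t1, t2, t3⟩ := build_univ univ d hd
  have hT0 : IsValid T0 (fun x => (1/2 : ℝ) ^ (d x)) := by
    refine ⟨t1, fun x => by simp [t2], fun x _ => ?_⟩
    have := t3 x (mem_univ _)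
    simp [DTree.depth, this]
  have hdep : ∀ x, T0.depth x = d x := fun x => by
    have := t3 x (mem_univ _)
    simp [DTree.depth, this]
  have ho := opt_le _ hμ T0 hT0
  have hk := kraft T T.depth hT.nodup (fun x hx => hT.finds x ((hT.mem_leaves x).1 hx))
  have huniv : T.leaves.toFinset = univ := by
    ext x; simp [hT.mem_leaves]
  have hg : T.depth = d := by
    apply gibbs d T.depth hd (by rw [← huniv, hk])
    have h : cost T (fun x => (1/2 : ℝ) ^ (d x)) ≤ cost T0 (fun x => (1/2 : ℝ) ^ (d x)) := by linarith
    simpa only [cost, hdep] using h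
  cases T with
  | leaf y =>
    have : (univ : Finset (Fin n)).card = 1 := by rw [← huniv]; simp [DTree.leaves]
    simp at this; omega
  | node q t f =>
    refine ⟨q, ?_, ?_⟩
    · exact_mod_cast hTQ (by simp [DTree.questions])
    · have := node_half q t f d hT.nodup (fun x hx => by
        rw [hT.finds x ((hT.mem_leaves x).1 hx), hg])
      rw [huniv] at this
      simpa using this

lemma head_tail {n k : ℕ} (hn : n = 5 * 2 ^ k) (Q : Finset (Finset (Fin n)))
    (hQ : AchievesProlixity Q 0) (H : Finset (Fin n)) (hH : H.card = 2 * 2 ^ k - 1) :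
    ∃ A ∈ Q, (A ⊆ H ∧ A.card = 2 ^ k) ∨ (Aᶜ ⊆ H ∧ Aᶜ.card = 2 ^ k) := by
  have hm : 1 ≤ 2 ^ k := Nat.one_le_two_pow
  have hHc : (Hᶜ).card = n - (2 * 2 ^ k - 1) := by rw [card_compl, hH, Fintype.card_fin]
  have hne : (Hᶜ).Nonempty := by rw [← card_pos]; omega
  obtain ⟨d', hd'⟩ := exists_dyadic _ hne
  set d : Fin n → ℕ := fun x => if x ∈ H then k + 1 else k + 1 + d' x with hdd
  set w : ℝ := (1/2) ^ (k+1) with hw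
  have hwpos : 0 < w := by positivity
  have hwm : w * (2 * (2 ^ k : ℕ)) = 1 := by
    rw [hw]; push_cast; rw [← pow_succ', ← mul_pow]; norm_num
  have s1 : ∀ B ⊆ H, ∑ x ∈ B, (1/2 : ℝ) ^ (d x) = B.card * w := by
    intro B hB
    rw [sum_congr rfl (g := fun _ => w), sum_const, nsmul_eq_mul]
    intro x hx
    simp [hdd, hB hx, hw]
  have s2 : ∀ B ⊆ Hᶜ, ∑ x ∈ B, (1/2 : ℝ) ^ (d x) = w * ∑ x ∈ B, (1/2 : ℝ) ^ (d' x) := by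
    intro B hB
    rw [mul_sum]
    refine sum_congr rfl fun x hx => ?_
    have : x ∉ H := by simpa using hB hx
    simp only [hdd, this, if_false, pow_add, hw]
  have hsum : ∑ x, (1/2 : ℝ) ^ (d x) = 1 := by
    rw [← sum_add_sum_compl H, s1 H Subset.rfl, s2 _ Subset.rfl, hd', hH,
      Nat.cast_sub (by omega)]
    push_cast at hwm ⊢
    linarith
  obtain ⟨A, hA, hAs⟩ := root_split (by omega) Q hQ d hsum
  refine ⟨A, hA, ?_⟩
  have hsp : A = (A ∩ H) ∪ (A ∩ Hᶜ) := by
    rw [← inter_union_distrib_left]; simp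
  have hdj : Disjoint (A ∩ H) (A ∩ Hᶜ) := by
    rw [disjoint_left]; intro x; simp; tauto
  have hcA : A.card = (A ∩ H).card + (A ∩ Hᶜ).card := by
    conv_lhs => rw [hsp]
    rw [card_union_of_disjoint hdj]
  rw [hsp, sum_union hdj, s1 _ inter_subset_right, s2 _ inter_subset_right] at hAs
  set s := ∑ x ∈ A ∩ Hᶜ, (1/2 : ℝ) ^ (d' x) with hs
  have hs0 : 0 ≤ s := sum_nonneg fun _ _ => by positivity
  have hs1 : s ≤ 1 := by
    rw [← hd']
    exact sum_le_sum_of_subset_of_nonneg inter_subset_right (fun _ _ _ => by positivity)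
  have heq : ((A ∩ H).card : ℝ) + s = (2 ^ k : ℕ) := by
    have : w * (((A ∩ H).card : ℝ) + s) = w * (2 ^ k : ℕ) := by linarith
    exact mul_left_cancel₀ hwpos.ne' this
  have hle1 : (A ∩ H).card ≤ 2 ^ k := by
    exact_mod_cast (by linarith : ((A ∩ H).card : ℝ) ≤ (2 ^ k : ℕ))
  have hle2 : 2 ^ k ≤ (A ∩ H).card + 1 := by
    exact_mod_cast (by linarith : ((2 ^ k : ℕ) : ℝ) ≤ (A ∩ H).card + 1)
  rcases Nat.lt_or_ge (A ∩ H).card (2 ^ k) with hlt | hge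
  · right
    have hc1 : (A ∩ H).card + 1 = 2 ^ k := by omega
    have hs1' : s = 1 := by
      have : ((A ∩ H).card : ℝ) + 1 = (2 ^ k : ℕ) := by exact_mod_cast hc1
      linarith
    have hall : Hᶜ ⊆ A := by
      by_contra hns
      obtain ⟨x, hx, hxA⟩ := not_subset.1 hns
      have : s < 1 := by
        rw [← hd']
        refine sum_lt_sum_of_subset inter_subset_right hx ?_ (by positivity) (fun _ _ _ => by positivity)
        simp [hxA]
      linarith
    refine ⟨by rw [← compl_subset_compl]; simpa using hall, ?_⟩
    rw [inter_eq_right.2 hall] at hcA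
    rw [card_compl, Fintype.card_fin, hcA, hHc]
    omega
  · left
    have hc1 : (A ∩ H).card = 2 ^ k := by omega
    have hs1' : s = 0 := by
      rw [hc1] at heq; linarith
    have hemp : A ∩ Hᶜ = ∅ := by
      by_contra hns
      have : 0 < s := sum_pos (fun _ _ => by positivity) (nonempty_iff_ne_empty.2 hns)
      linarith
    rw [hemp] at hcA
    refine ⟨?_, by simpa [hc1] using hcA⟩
    rw [hsp, hemp]; simp

lemma supersets {n m h : ℕ} (B : Finset (Fin n)) (hB : B.card = m) :
    ((powersetCard h (univ : Finset (Fin n))).filter (B ⊆ ·)).card ≤ (n - m).choose (h - m) := by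
  have : (n - m).choose (h - m) = (powersetCard (h - m) Bᶜ).card := by
    rw [card_powersetCard, card_compl, Fintype.card_fin, hB]
  rw [this]
  apply card_le_card_of_injOn (fun H => H \ B)
  · intro H hH
    simp only [coe_filter, mem_powersetCard, Set.mem_setOf_eq, mem_coe, subset_univ, true_and] at hH ⊢
    refine ⟨fun x hx => by simp at hx ⊢; exact hx.2, ?_⟩
    rw [card_sdiff_of_subset hH.2, hH.1, hB]
  · intro H hH H' hH' he
    simp only [coe_filter, mem_powersetCard, Set.mem_setOf_eq] at hH hH' he
    rw [← sdiff_union_of_subset hH.2, he, sdiff_union_of_subset hH'.2]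

lemma mode (m i : ℕ) : (5 * m).choose i * 4 ^ (5 * m - i) ≤ (5 * m).choose m * 4 ^ (4 * m) := by
  have hup : ∀ j, j ≤ m → (5 * m).choose (m - j) * 4 ^ (5 * m - (m - j)) ≤ (5 * m).choose m * 4 ^ (4 * m) := by
    intro j
    induction j with
    | zero => intro _; simp [show 5 * m - m = 4 * m by omega]
    | succ j ih =>
      intro hj
      refine le_trans ?_ (ih (by omega))
      obtain ⟨i, hi⟩ : ∃ i, i + 1 = m - j := ⟨m - j - 1, by omega⟩
      have h1 : m - (j + 1) = i := by omega
      rw [h1, ← hi]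
      have h2 : 5 * m - i = (5 * m - (i + 1)) + 1 := by omega
      have h3 := Nat.choose_succ_right_eq (5 * m) i
      rw [h2, pow_succ, mul_comm (4 ^ _) 4, ← mul_assoc]
      apply Nat.mul_le_mul_right
      have h4 : 4 * (i + 1) ≤ 5 * m - i := by omega
      have : (5 * m).choose i * 4 * (i + 1) ≤ (5 * m).choose (i + 1) * (i + 1) := by
        rw [h3, mul_assoc]
        exact Nat.mul_le_mul_left _ h4
      exact Nat.le_of_mul_le_mul_right this (by omega)
  have hdn : ∀ j, (5 * m).choose (m + j) * 4 ^ (5 * m - (m + j)) ≤ (5 * m).choose m * 4 ^ (4 * m) := by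
    intro j
    induction j with
    | zero => simp [show 5 * m - m = 4 * m by omega]
    | succ j ih =>
      by_cases hj : m + (j + 1) ≤ 5 * m
      · refine le_trans ?_ ih
        have h2 : 5 * m - (m + j) = (5 * m - (m + j + 1)) + 1 := by omega
        have h3 := Nat.choose_succ_right_eq (5 * m) (m + j)
        rw [← add_assoc, h2, pow_succ, mul_comm (4 ^ _) 4, ← mul_assoc]
        apply Nat.mul_le_mul_right
        have h4 : 5 * m - (m + j) ≤ 4 * (m + j + 1) := by omega
        have : (5 * m).choose (m + j + 1) * (m + j + 1) ≤ (5 * m).choose (m + j) * 4 * (m + j + 1) := by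
          rw [h3, mul_assoc]
          exact Nat.mul_le_mul_left _ h4
        exact Nat.le_of_mul_le_mul_right this (by omega)
      · rw [Nat.choose_eq_zero_of_lt (by omega)]; simp
  rcases le_total i m with h | h
  · have := hup (m - i) (by omega)
    rwa [show m - (m - i) = i by omega] at this
  · have := hdn (i - m)
    rwa [show m + (i - m) = i by omega] at this

lemma mode_sum (m : ℕ) : 5 ^ (5 * m) ≤ (5 * m + 1) * ((5 * m).choose m * 4 ^ (4 * m)) := by
  have h := add_pow 1 4 (5 * m)
  norm_num at h
  rw [h]
  calc _ ≤ ∑ i ∈ range (5 * m + 1), ((5 * m).choose m * 4 ^ (4 * m)) := by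
        refine sum_le_sum fun i _ => ?_
        rw [mul_comm]; exact mode m i
    _ = _ := by simp

lemma lower {n k : ℕ} (hn : n = 5 * 2 ^ k) (Q : Finset (Finset (Fin n)))
    (hQ : AchievesProlixity Q 0) : (5/4 : ℝ) ^ n ≤ 2 * (n + 1) * Q.card := by
  set m := 2 ^ k with hm
  have hm1 : 1 ≤ m := Nat.one_le_two_pow
  have h1 : (n.choose (2 * m - 1)) ≤ Q.card * (2 * (4 * m).choose (m - 1)) := by
    calc n.choose (2 * m - 1) = (powersetCard (2 * m - 1) (univ : Finset (Fin n))).card := by simp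
      _ ≤ (Q.biUnion fun A => (powersetCard (2 * m - 1) univ).filter (A ⊆ ·) ∩ 
            (powersetCard (2 * m - 1) univ).filter (fun _ => A.card = m) ∪
            ((powersetCard (2 * m - 1) univ).filter (Aᶜ ⊆ ·) ∩ 
            (powersetCard (2 * m - 1) univ).filter (fun _ => Aᶜ.card = m))).card := by
          apply card_le_card
          intro H hH
          have hH' := hH
          rw [mem_powersetCard] at hH
          obtain ⟨A, hA, h⟩ := head_tail hn Q hQ H hH.2
          simp only [mem_biUnion, mem_union, mem_inter, mem_filter]
          exact ⟨A, hA, by tauto⟩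
      _ ≤ _ := by
          apply card_biUnion_le_card_mul
          have key : ∀ B : Finset (Fin n), ((powersetCard (2 * m - 1) univ).filter (B ⊆ ·) ∩ 
            (powersetCard (2 * m - 1) univ).filter (fun _ => B.card = m)).card ≤ (4 * m).choose (m - 1) := by
            intro B
            by_cases hB : B.card = m
            · refine (card_le_card inter_subset_left).trans ?_
              refine (supersets B hB).trans ?_
              rw [show n - m = 4 * m by omega, show 2 * m - 1 - m = m - 1 by omega]
            · simp [hB]
          intro A _
          refine (card_union_le _ _).trans ?_
          have h1 := key A
          have h2 := key Aᶜ
          omega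
  have h2 := Nat.choose_mul (n := n) (k := 2 * m - 1) (s := m) (by omega)
  rw [show n - m = 4 * m by omega, show 2 * m - 1 - m = m - 1 by omega] at h2
  have h3 : (2 * m - 1).choose m ≤ 4 ^ m := by
    refine (Nat.choose_le_two_pow _ _).trans ?_
    rw [show 4 = 2 ^ 2 by norm_num, ← pow_mul]
    exact Nat.pow_le_pow_right (by norm_num) (by omega)
  have h4 : n.choose m ≤ 2 * Q.card * 4 ^ m := by
    have hp : 0 < (4 * m).choose (m - 1) := Nat.choose_pos (by omega)
    refine Nat.le_of_mul_le_mul_right ?_ hp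
    rw [← h2]
    calc _ ≤ Q.card * (2 * (4 * m).choose (m - 1)) * 4 ^ m := Nat.mul_le_mul h1 h3
      _ = _ := by ring
  have h5 := mode_sum m
  rw [← hn] at h5
  have h6 : 5 ^ n ≤ 2 * (n + 1) * Q.card * 4 ^ n := by
    calc 5 ^ n ≤ (n + 1) * (n.choose m * 4 ^ (4 * m)) := h5
      _ ≤ (n + 1) * (2 * Q.card * 4 ^ m * 4 ^ (4 * m)) := by gcongr
      _ = 2 * (n + 1) * Q.card * (4 ^ m * 4 ^ (4 * m)) := by ring
      _ = _ := by rw [← pow_add, show m + 4 * m = n by omega]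
  have h7 : (5:ℝ) ^ n ≤ 2 * (n + 1) * Q.card * 4 ^ n := by exact_mod_cast h6
  rw [div_pow, div_le_iff₀ (by positivity)]
  exact h7

end TQ

namespace TQ
open Finset

lemma binom_bound (N a k : ℕ) (ha : a ≤ N) (hk : 2 * a - N ≤ k) :
    4 ^ a ≤ 4 ^ k * ((N + 1) * N.choose a) := by
  have key : ∀ b, 2 * b ≤ N → 4 ^ b ≤ (N + 1) * N.choose b := by
    intro b hb
    refine (Nat.four_pow_le_two_mul_add_one_mul_central_binom b).trans ?_
    exact Nat.mul_le_mul (by omega) (Nat.choose_le_choose b hb)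
  rcases le_total (2 * a) N with h | h
  · exact (key a h).trans (Nat.le_mul_of_pos_left _ (by positivity))
  · have h1 := key (N - a) (by omega)
    rw [Nat.choose_symm ha] at h1
    calc 4 ^ a ≤ 4 ^ (k + (N - a)) := Nat.pow_le_pow_right (by norm_num) (by omega)
      _ = 4 ^ k * 4 ^ (N - a) := pow_add _ _ _
      _ ≤ _ := Nat.mul_le_mul_left _ h1

lemma profile_count {α ι : Type} [Fintype α] [DecidableEq α] [Fintype ι] [DecidableEq ι]
    (f : α → ι) (S : Finset α) :
    ∏ e, (univ.filter (f · = e)).card.choose (S.filter (f · = e)).card ≤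
      ((univ : Finset (Finset α)).filter
        (fun A => ∀ e, (A.filter (f · = e)).card = (S.filter (f · = e)).card)).card := by
  have h : ∏ e, (univ.filter (f · = e)).card.choose (S.filter (f · = e)).card =
      (Fintype.piFinset (fun e => powersetCard (S.filter (f · = e)).card (univ.filter (f · = e)))).card := by
    rw [Fintype.card_piFinset]; simp
  rw [h]
  have key : ∀ g ∈ Fintype.piFinset (fun e => powersetCard (S.filter (f · = e)).card (univ.filter (f · = e))),
      ∀ e, ((univ.biUnion g).filter (f · = e)) = g e := by
    intro g hg e
    simp only [Fintype.mem_piFinset, mem_powersetCard] at hg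
    ext x
    simp only [mem_filter, mem_biUnion, mem_univ, true_and]
    constructor
    · rintro ⟨⟨e', he'⟩, hx⟩
      have := (hg e').1 he'
      simp at this
      rw [← hx, this]; exact he'
    · intro hx
      have := (hg e).1 hx
      simp at this
      exact ⟨⟨e, hx⟩, this⟩
  apply card_le_card_of_injOn (fun g => univ.biUnion g)
  · intro g hg
    simp only [coe_filter, mem_univ, true_and, Set.mem_ofPred_eq]
    intro e
    rw [key g hg e]
    simp only [mem_coe, Fintype.mem_piFinset, mem_powersetCard] at hg
    exact (hg e).2
  · intro g hg g' hg' he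
    funext e
    simp only at he
    rw [← key g hg e, he, key g' hg' e]

lemma exists_cut {α : Type} (Y : Finset α) (d : α → ℕ) (K : ℕ)
    (hK : 1 ≤ K) (hn : Y.card ≤ K * K) :
    ∃ D, K ≤ D ∧ D < 2 * K ∧ 2 ^ D * ∑ x ∈ Y with D < d x, (1/2 : ℝ) ^ (d x) ≤ K := by
  by_contra hcon
  push Not at hcon
  have h1 : ∑ D ∈ Ico K (2 * K), (K : ℝ) <
      ∑ D ∈ Ico K (2 * K), 2 ^ D * ∑ x ∈ Y with D < d x, (1/2 : ℝ) ^ (d x) := by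
    apply sum_lt_sum_of_nonempty
    · rw [nonempty_Ico]; omega
    · intro D hD
      rw [mem_Ico] at hD
      exact hcon D hD.1 hD.2
  have h2 : ∑ D ∈ Ico K (2 * K), (2:ℝ) ^ D * ∑ x ∈ Y with D < d x, (1/2 : ℝ) ^ (d x) ≤ Y.card := by
    calc _ = ∑ x ∈ Y, ∑ D ∈ Ico K (2 * K) with D < d x, (2:ℝ) ^ D * (1/2 : ℝ) ^ (d x) := by
          simp_rw [mul_sum, sum_filter]
          rw [sum_comm]
      _ ≤ ∑ x ∈ Y, 1 := by
          refine sum_le_sum fun x _ => ?_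
          calc _ ≤ ∑ D ∈ range (d x), (2:ℝ) ^ D * (1/2 : ℝ) ^ (d x) := by
                apply sum_le_sum_of_subset_of_nonneg
                · intro D; simp
                · intros; positivity
            _ = (2 ^ (d x) - 1) * (1/2 : ℝ) ^ (d x) := by
                rw [← sum_mul, geom_sum_eq (by norm_num)]; norm_num
            _ ≤ 1 := by
                rw [sub_mul, ← mul_pow]; norm_num
      _ = _ := by simp
  simp only [sum_const, Nat.card_Ico, nsmul_eq_mul] at h1
  have h3 : (Y.card : ℝ) ≤ K * K := by exact_mod_cast hn
  rw [show 2 * K - K = K by omega] at h1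
  linarith

lemma exists_profile {α : Type} [Fintype α] [DecidableEq α] (Y : Finset α) (d : α → ℕ) (K : ℕ)
    (hK : 1 ≤ K) (hn : Fintype.card α ≤ K * K) (hY : 2 ≤ Y.card)
    (hs : ∑ x ∈ Y, (1/2 : ℝ) ^ (d x) = 1) :
    ∃ (f : α → Fin (2 * K)) (S : Finset α), (∀ x, (f x : ℕ) ≠ 0 → x ∈ Y ∧ (f x : ℕ) = d x) ∧
      (∀ x ∈ S, (f x : ℕ) ≠ 0) ∧ ∑ x ∈ S, (1/2 : ℝ) ^ (f x : ℕ) = 1/2 ∧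
      ∑ e, (2 * (S.filter (f · = e)).card - (univ.filter (f · = e)).card) ≤ 4 * K := by
  obtain ⟨D, hD1, hD2, hD3⟩ := exists_cut Y d K hK ((card_le_univ Y).trans hn)
  have hd := one_le_of_sum Y d hY hs
  set f : α → Fin (2 * K) := fun x => if h : x ∈ Y ∧ d x ≤ D then ⟨d x, by omega⟩ else ⟨0, by omega⟩ with hf
  set H := Y.filter (fun x => d x ≤ D) with hH
  have hfH : ∀ x ∈ H, (f x : ℕ) = d x := by
    intro x hx
    rw [hH, mem_filter] at hx
    simp [hf, hx]
  have hfH' : ∀ x, (f x : ℕ) ≠ 0 → x ∈ H := by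
    intro x hx
    by_contra h
    rw [hH, mem_filter] at h
    simp [hf, h] at hx
  have hHsum : ∑ x ∈ H, (1/2 : ℝ) ^ (d x) = 1 - ∑ x ∈ Y with D < d x, (1/2 : ℝ) ^ (d x) := by
    have := sum_filter_add_sum_filter_not Y (fun x => d x ≤ D) (fun x => (1/2 : ℝ) ^ (d x))
    simp only [not_le] at this
    linarith
  set τ := ∑ x ∈ Y with D < d x, (1/2 : ℝ) ^ (d x) with hτ
  have hτK : τ ≤ K * (1/2) ^ D := by
    rw [one_div, inv_pow, ← div_eq_mul_inv, le_div_iff₀ (by positivity)]; linarith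
  have hτ2 : τ ≤ 1/2 := by
    have h1 : 2 * K ≤ 2 ^ D := by
      calc 2 * K ≤ 2 ^ K := by
            obtain ⟨j, rfl⟩ := Nat.exists_eq_add_of_le hK
            have := Nat.lt_two_pow_self (n := j)
            rw [pow_add]; omega
        _ ≤ 2 ^ D := Nat.pow_le_pow_right (by norm_num) hD1
    have h2 : (2:ℝ) * K ≤ 2 ^ D := by exact_mod_cast h1
    have hp : (0:ℝ) < 2 ^ D := by positivity
    by_contra hc
    push Not at hc
    nlinarith
  -- choose half of each level
  have hg : ∀ e : Fin (2 * K), ∃ t ⊆ H.filter (f · = e), t.card = ((H.filter (f · = e)).card + 1) / 2 := by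
    intro e
    apply exists_subset_card_eq
    omega
  choose g hg1 hg2 using hg
  set G0 := H.filter (fun x => x ∈ g (f x)) with hG0
  have hG0e : ∀ e, G0.filter (f · = e) = g e := by
    intro e
    ext x
    simp only [hG0, mem_filter]
    constructor
    · rintro ⟨⟨_, h⟩, rfl⟩; exact h
    · intro h
      have := hg1 e h
      rw [mem_filter] at this
      obtain ⟨h1, rfl⟩ := this
      exact ⟨⟨h1, h⟩, rfl⟩
  have hG0H : G0 ⊆ H := filter_subset _ _
  have hlev : ∀ B ⊆ H, ∑ x ∈ B, (1/2 : ℝ) ^ (d x) = ∑ e, (B.filter (f · = e)).card * (1/2 : ℝ) ^ (e : ℕ) := by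
    intro B hB
    rw [← sum_fiberwise B f]
    refine sum_congr rfl fun e _ => ?_
    rw [← nsmul_eq_mul, ← sum_const]
    refine sum_congr rfl fun x hx => ?_
    rw [mem_filter] at hx
    rw [← hfH x (hB hx.1), hx.2]
  have hG0sum : (1 - τ) / 2 ≤ ∑ x ∈ G0, (1/2 : ℝ) ^ (d x) := by
    rw [hlev G0 hG0H, ← hHsum, hlev H Subset.rfl, div_eq_mul_inv, sum_mul]
    refine sum_le_sum fun e _ => ?_
    rw [hG0e, hg2]
    have : ((H.filter (f · = e)).card : ℝ) ≤ 2 * (((H.filter (f · = e)).card + 1) / 2 : ℕ) := by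
      exact_mod_cast (by omega)
    have hp : (0:ℝ) < (1/2) ^ (e : ℕ) := by positivity
    nlinarith
  -- extras
  have hX : ∃ X ⊆ H, X.card ≤ K ∧ 1/2 ≤ ∑ x ∈ G0 ∪ X, (1/2 : ℝ) ^ (d x) := by
    by_cases hc : (H \ G0).card ≤ K
    · refine ⟨H \ G0, sdiff_subset, hc, ?_⟩
      rw [union_sdiff_of_subset hG0H, hHsum]; linarith
    · obtain ⟨X, hX, hXc⟩ := exists_subset_card_eq (not_le.1 hc).le
      refine ⟨X, hX.trans sdiff_subset, hXc.le, ?_⟩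
      rw [sum_union]
      · have : ∑ x ∈ X, (1/2 : ℝ) ^ D ≤ ∑ x ∈ X, (1/2 : ℝ) ^ (d x) := by
          refine sum_le_sum fun x hx => ?_
          have := sdiff_subset (hX hx)
          rw [hH, mem_filter] at this
          exact pow_le_pow_of_le_one (by norm_num) (by norm_num) this.2
        rw [sum_const, hXc, nsmul_eq_mul] at this
        have hτ0 : 0 ≤ τ := sum_nonneg fun _ _ => by positivity
        linarith
      · exact disjoint_of_subset_right hX disjoint_sdiff
  obtain ⟨X, hXH, hXc, hXs⟩ := hX
  have hGH : G0 ∪ X ⊆ H := union_subset hG0H hXH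
  obtain ⟨S, hSG, hS⟩ := half_subset d (G0 ∪ X)
    (fun x hx => hd x (filter_subset _ _ (hGH hx))) hXs
  refine ⟨f, S, ?_, ?_, ?_, ?_⟩
  · intro x hx
    have := hfH' x hx
    exact ⟨filter_subset _ _ this, hfH x this⟩
  · intro x hx
    have h1 := hGH (hSG hx)
    have := hd x (filter_subset _ _ h1)
    rw [hfH x h1]; omega
  · refine Eq.trans ?_ hS
    refine sum_congr rfl fun x hx => ?_
    rw [hfH x (hGH (hSG hx))]
  · calc _ ≤ ∑ e, (1 + 2 * (X.filter (f · = e)).card) := by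
          refine sum_le_sum fun e _ => ?_
          have h1 : (S.filter (f · = e)).card ≤ (g e).card + (X.filter (f · = e)).card := by
            rw [← hG0e]
            refine le_trans (card_le_card ?_) (card_union_le _ _)
            rw [← filter_union]
            exact filter_subset_filter _ hSG
          have h2 : (H.filter (f · = e)).card ≤ (univ.filter (f · = e)).card :=
            card_le_card (filter_subset_filter _ (subset_univ _))
          have := hg2 e
          omega
      _ = 2 * K + 2 * X.card := by
          rw [sum_add_distrib, ← mul_sum, ← card_eq_sum_card_fiberwise (fun _ _ => by simp)]
          simp
      _ ≤ _ := by omega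

/-- The family of candidate questions attached to a truncated level function. -/
noncomputable def famE {α : Type} [Fintype α] {K : ℕ} (f : α → Fin (2 * K)) (i : ℕ) :
    Finset (Finset α) := by
  classical
  exact (powersetCard i univ).filter
    (fun A => (∀ x ∈ A, (f x : ℕ) ≠ 0) ∧ ∑ x ∈ A, (1/2 : ℝ) ^ (f x : ℕ) = 1/2)

lemma mem_famE {α : Type} [Fintype α] {K : ℕ} (f : α → Fin (2 * K)) (i : ℕ) (A : Finset α) :
    A ∈ famE f i ↔ A.card = i ∧ (∀ x ∈ A, (f x : ℕ) ≠ 0) ∧ ∑ x ∈ A, (1/2 : ℝ) ^ (f x : ℕ) = 1/2 := by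
  classical
  simp only [famE, mem_filter, mem_powersetCard, subset_univ, true_and]

lemma famE_large {α : Type} [Fintype α] [DecidableEq α] (K : ℕ) (f : α → Fin (2 * K)) (S : Finset α)
    (h1 : ∀ x ∈ S, (f x : ℕ) ≠ 0) (h2 : ∑ x ∈ S, (1/2 : ℝ) ^ (f x : ℕ) = 1/2)
    (h3 : ∑ e, (2 * (S.filter (f · = e)).card - (univ.filter (f · = e)).card) ≤ 4 * K) :
    4 ^ S.card ≤ 4 ^ (4 * K) * (Fintype.card α + 1) ^ (2 * K) * (famE f S.card).card := by
  have hE : ((univ : Finset (Finset α)).filter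
        (fun A => ∀ e, (A.filter (f · = e)).card = (S.filter (f · = e)).card)) ⊆ famE f S.card := by
    intro A hA
    simp only [mem_filter, mem_univ, true_and] at hA
    rw [mem_famE]
    refine ⟨?_, ?_, ?_⟩
    · rw [card_eq_sum_card_fiberwise (f := f) (t := univ) (fun _ _ => by simp),
        card_eq_sum_card_fiberwise (f := f) (s := S) (t := univ) (fun _ _ => by simp)]
      exact sum_congr rfl fun e _ => hA e
    · intro x hx h0
      have hpos : 0 < (S.filter (f · = f x)).card := by
        rw [← hA (f x), card_pos]
        exact ⟨x, by simp [hx]⟩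
      obtain ⟨y, hy⟩ := card_pos.1 hpos
      rw [mem_filter] at hy
      exact h1 y hy.1 (by rw [hy.2, h0])
    · have hl : ∀ B : Finset α, ∑ x ∈ B, (1/2 : ℝ) ^ (f x : ℕ) =
          ∑ e, (B.filter (f · = e)).card * (1/2 : ℝ) ^ (e : ℕ) := by
        intro B
        rw [← sum_fiberwise B f]
        refine sum_congr rfl fun e _ => ?_
        rw [← nsmul_eq_mul, ← sum_const]
        refine sum_congr rfl fun x hx => ?_
        rw [mem_filter] at hx
        rw [hx.2]
      refine Eq.trans ?_ h2
      rw [hl, hl]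
      exact sum_congr rfl fun e _ => by rw [hA e]
  have hcard : ∏ e, (univ.filter (f · = e)).card.choose (S.filter (f · = e)).card ≤
      (famE f S.card).card := by
    refine (profile_count f S).trans (card_le_card ?_)
    convert hE
  calc 4 ^ S.card = ∏ e, 4 ^ (S.filter (f · = e)).card := by
        rw [prod_pow_eq_pow_sum, ← card_eq_sum_card_fiberwise (fun _ _ => by simp)]
    _ ≤ ∏ e, (4 ^ (2 * (S.filter (f · = e)).card - (univ.filter (f · = e)).card) *
          ((Fintype.card α + 1) * (univ.filter (f · = e)).card.choose (S.filter (f · = e)).card)) := by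
        refine prod_le_prod' fun e _ => ?_
        refine (binom_bound _ _ _ (card_le_card (filter_subset_filter _ (subset_univ _))) le_rfl).trans ?_
        gcongr
        exact card_le_univ _
    _ = 4 ^ (∑ e, (2 * (S.filter (f · = e)).card - (univ.filter (f · = e)).card)) *
          ((Fintype.card α + 1) ^ (2 * K) *
          ∏ e, (univ.filter (f · = e)).card.choose (S.filter (f · = e)).card) := by
        rw [prod_mul_distrib, prod_mul_distrib, prod_pow_eq_pow_sum]; simp
    _ ≤ 4 ^ (4 * K) * ((Fintype.card α + 1) ^ (2 * K) * (famE f S.card).card) := by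
        gcongr; norm_num
    _ = _ := by ring

lemma choose_bound (n i : ℕ) : (n.choose i : ℝ) ≤ (5/4) ^ n * 4 ^ i := by
  by_cases hi : i ≤ n
  · have h := add_pow (1/4 : ℝ) 1 n
    norm_num at h
    rw [h]
    have : (1/4 : ℝ) ^ i * (n.choose i) ≤ ∑ m ∈ range (n + 1), (1/4 : ℝ) ^ m * (n.choose m) :=
      single_le_sum (f := fun m => (1/4 : ℝ) ^ m * (n.choose m)) (fun _ _ => by positivity) (by simp; omega)
    calc (n.choose i : ℝ) = (1/4 : ℝ) ^ i * (n.choose i) * 4 ^ i := by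
          rw [mul_right_comm, ← mul_pow]; norm_num
      _ ≤ _ := by gcongr
  · rw [Nat.choose_eq_zero_of_lt (by omega)]; simp; positivity

lemma greedy {β J : Type} [DecidableEq β] [DecidableEq J] (U : Finset β) (I : Finset J) (E : J → Finset β)
    (R : ℝ) (hR : 1 ≤ R) (hEU : ∀ j ∈ I, E j ⊆ U) (hE : ∀ j ∈ I, (U.card : ℝ) ≤ R * (E j).card)
    (k : ℕ) : (∀ j ∈ I, (E j).Nonempty) → ∃ Q : Finset β, Q.card ≤ k ∧
      ((I.filter (fun j => ∀ q ∈ Q, q ∉ E j)).card : ℝ) ≤ I.card * (1 - 1/R) ^ k := by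
  intro hne
  have hR0 : 0 < R := by linarith
  have h1R : 0 ≤ 1 - 1/R := by
    rw [sub_nonneg, div_le_one hR0]; exact hR
  induction k with
  | zero => exact ⟨∅, by simp, by simp⟩
  | succ k ih =>
    obtain ⟨Q, hQ1, hQ2⟩ := ih
    set I' := I.filter (fun j => ∀ q ∈ Q, q ∉ E j) with hI'
    rcases I'.eq_empty_or_nonempty with h0 | h0
    · refine ⟨Q, by omega, ?_⟩
      rw [← hI', h0, card_empty, Nat.cast_zero]
      exact mul_nonneg (Nat.cast_nonneg _) (pow_nonneg h1R _)
    · have hUne : U.Nonempty := by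
        obtain ⟨j, hj⟩ := h0
        have hjI := filter_subset _ _ hj
        exact (hne j hjI).mono (hEU j hjI)
      have hdc : ∑ u ∈ U, ((I'.filter (fun j => u ∈ E j)).card : ℝ) = ∑ j ∈ I', ((E j).card : ℝ) := by
        have := sum_card_bipartiteAbove_eq_sum_card_bipartiteBelow (fun u j => u ∈ E j) (s := U) (t := I')
        have h2 : ∀ j ∈ I', bipartiteBelow (fun u j => u ∈ E j) U j = E j := by
          intro j hj
          ext u
          simp only [bipartiteBelow, mem_filter]
          exact ⟨fun h => h.2, fun h => ⟨hEU j (filter_subset _ _ hj) h, h⟩⟩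
        have h3 : ∑ b ∈ I', (bipartiteBelow (fun u j => u ∈ E j) U b).card = ∑ b ∈ I', (E b).card :=
          sum_congr rfl (fun j hj => by rw [h2 j hj])
        rw [h3] at this
        exact_mod_cast this
      have hex : ∃ u ∈ U, (I'.card : ℝ) / R ≤ ((I'.filter (fun j => u ∈ E j)).card : ℝ) := by
        apply exists_le_of_sum_le hUne
        rw [hdc, sum_const, nsmul_eq_mul, mul_div_assoc', div_le_iff₀ hR0, sum_mul]
        calc (U.card : ℝ) * I'.card = ∑ j ∈ I', (U.card : ℝ) := by simp [mul_comm]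
          _ ≤ _ := sum_le_sum fun j hj => by
              rw [mul_comm]; exact hE j (filter_subset _ _ hj)
      obtain ⟨u, -, hu⟩ := hex
      refine ⟨insert u Q, (card_insert_le _ _).trans (by omega), ?_⟩
      have heq : I.filter (fun j => ∀ q ∈ insert u Q, q ∉ E j) = I'.filter (fun j => u ∉ E j) := by
        ext j
        simp only [hI', mem_filter, mem_insert, forall_eq_or_imp]
        tauto
      rw [heq]
      have hc := card_filter_add_card_filter_not (s := I') (fun j => u ∈ E j)
      have hc' : ((I'.filter (fun j => u ∈ E j)).card : ℝ) + (I'.filter (fun j => u ∉ E j)).card = I'.card := by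
        exact_mod_cast hc
      calc ((I'.filter (fun j => u ∉ E j)).card : ℝ) ≤ I'.card - I'.card / R := by linarith
        _ = I'.card * (1 - 1/R) := by ring
        _ ≤ I.card * (1 - 1/R) ^ k * (1 - 1/R) := by gcongr
        _ = _ := by ring

lemma greedy_hit {β J : Type} [DecidableEq β] [DecidableEq J] (U : Finset β) (I : Finset J)
    (E : J → Finset β)
    (R : ℝ) (hR : 1 ≤ R) (hEU : ∀ j ∈ I, E j ⊆ U) (hE : ∀ j ∈ I, (U.card : ℝ) ≤ R * (E j).card)
    (k : ℕ) (hne : ∀ j ∈ I, (E j).Nonempty) (hlt : I.card * (1 - 1/R) ^ k < 1) :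
    ∃ Q : Finset β, Q.card ≤ k ∧ ∀ j ∈ I, ∃ q ∈ Q, q ∈ E j := by
  obtain ⟨Q, hQ1, hQ2⟩ := greedy U I E R hR hEU hE k hne
  refine ⟨Q, hQ1, ?_⟩
  have hemp := lt_of_le_of_lt hQ2 hlt
  rw [Nat.cast_lt_one, card_eq_zero, filter_eq_empty_iff] at hemp
  intro j hj
  have := hemp hj
  push Not at this
  exact this

lemma upper (n K : ℕ) (hK : 1 ≤ K) (hn : n ≤ K * K) :
    ∃ Q : Finset (Finset (Fin n)), AchievesProlixity Q 0 ∧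
      (Q.card : ℝ) ≤ (n + 1) * (((5/4) ^ n * (4 ^ (4 * K) * (n + 1) ^ (2 * K))) * (2 * K * n + 1) + 1) := by
  set R : ℝ := (5/4) ^ n * (4 ^ (4 * K) * (n + 1) ^ (2 * K)) with hRdef
  have hR : 1 ≤ R := by
    have h1 : (1:ℝ) ≤ (5/4) ^ n := one_le_pow₀ (by norm_num)
    have h2 : (1:ℝ) ≤ 4 ^ (4 * K) := one_le_pow₀ (by norm_num)
    have h3 : (1:ℝ) ≤ (n + 1) ^ (2 * K) := one_le_pow₀ (by linarith [Nat.cast_nonneg (α := ℝ) n])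
    exact one_le_mul_of_one_le_of_one_le h1 (one_le_mul_of_one_le_of_one_le h2 h3)
  have hR0 : 0 < R := by linarith
  set k := ⌊R * (2 * K * n + 1)⌋₊ + 1 with hk
  have hk1 : (k : ℝ) ≤ R * (2 * K * n + 1) + 1 := by
    rw [hk]; push_cast
    have := Nat.floor_le (by positivity : 0 ≤ R * (2 * K * n + 1))
    linarith
  have hk2 : R * (2 * K * n + 1) < k := by
    rw [hk]; push_cast
    exact Nat.lt_floor_add_one _
  have hlev : ∀ i : ℕ, ∃ Q : Finset (Finset (Fin n)), Q.card ≤ k ∧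
      ∀ f : Fin n → Fin (2 * K), (n.choose i : ℝ) ≤ R * (famE f i).card → (famE f i).Nonempty →
        ∃ A ∈ Q, A ∈ famE f i := by
    intro i
    classical
    set I : Finset (Fin n → Fin (2 * K)) := univ.filter
      (fun f => (n.choose i : ℝ) ≤ R * (famE f i).card ∧ (famE f i).Nonempty) with hI
    have hlt : (I.card : ℝ) * (1 - 1/R) ^ k < 1 := by
      have h1R : 0 ≤ 1 - 1/R := by
        rw [sub_nonneg, div_le_one hR0]; exact hR
      have e1 : (1 - 1/R) ^ k ≤ Real.exp (-(k / R)) := by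
        have h1R : 0 ≤ 1 - 1/R := by
          rw [sub_nonneg, div_le_one hR0]; exact hR
        calc (1 - 1/R) ^ k ≤ (Real.exp (-(1/R))) ^ k := by
              gcongr
              exact Real.one_sub_le_exp_neg _
          _ = _ := by rw [← Real.exp_nat_mul]; congr 1; ring
      have e2 : (I.card : ℝ) ≤ Real.exp (2 * K * n) := by
        have : I.card ≤ (2 * K) ^ n := by
          refine (card_le_univ _).trans ?_
          simp
        calc (I.card : ℝ) ≤ ((2 * K : ℕ) : ℝ) ^ n := by exact_mod_cast this
          _ ≤ (Real.exp (2 * K)) ^ n := by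
              gcongr
              push_cast
              have := Real.add_one_le_exp (2 * K : ℝ)
              linarith
          _ = _ := by rw [← Real.exp_nat_mul]; congr 1; ring
      calc (I.card : ℝ) * (1 - 1/R) ^ k ≤ Real.exp (2 * K * n) * Real.exp (-(k / R)) :=
            mul_le_mul e2 e1 (pow_nonneg h1R _) (Real.exp_pos _).le
        _ = Real.exp (2 * K * n - k / R) := by rw [← Real.exp_add]; congr 1
        _ < 1 := by
            rw [Real.exp_lt_one_iff, sub_neg, lt_div_iff₀ hR0]
            nlinarith
    obtain ⟨Q, hQ1, hQ2⟩ := greedy_hit (powersetCard i (univ : Finset (Fin n))) I (fun f => famE f i) R hR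
      (fun f _ A hA => by rw [mem_famE] at hA; simp [hA.1])
      (fun f hf => by
        rw [hI, mem_filter] at hf
        simpa using hf.2.1) k
      (fun f hf => by
        rw [hI, mem_filter] at hf
        exact hf.2.2) hlt
    exact ⟨Q, hQ1, fun f hf1 hf2 => hQ2 f (by rw [hI, mem_filter]; exact ⟨mem_univ _, hf1, hf2⟩)⟩
  choose Q hQ1 hQ2 using hlev
  refine ⟨(range (n + 1)).biUnion Q, ?_, ?_⟩
  · apply hitter_achieves
    intro Y d hY hs
    obtain ⟨f, S, f1, f2, f3, f4⟩ := exists_profile Y d K hK (by simpa using hn) hY hs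
    have hlarge := famE_large K f S f2 f3 f4
    have hlarge' : (4:ℝ) ^ S.card ≤ 4 ^ (4 * K) * (n + 1) ^ (2 * K) * (famE f S.card).card := by
      rw [Fintype.card_fin] at hlarge
      exact_mod_cast hlarge
    have hSE : (famE f S.card).Nonempty := by
      refine ⟨S, ?_⟩
      rw [mem_famE]
      exact ⟨rfl, f2, f3⟩
    obtain ⟨A, hA, hAE⟩ := hQ2 S.card f (by
      calc (n.choose S.card : ℝ) ≤ (5/4) ^ n * 4 ^ S.card := choose_bound _ _
        _ ≤ (5/4) ^ n * (4 ^ (4 * K) * (n + 1) ^ (2 * K) * (famE f S.card).card) := by gcongr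
        _ = _ := by rw [hRdef]; ring) hSE
    refine ⟨A, ?_, ?_⟩
    · rw [mem_biUnion]
      refine ⟨S.card, ?_, hA⟩
      have := card_le_univ S
      rw [Fintype.card_fin] at this
      rw [mem_range]; omega
    · rw [mem_famE] at hAE
      obtain ⟨-, a1, a2⟩ := hAE
      have hAY : A ⊆ Y := fun x hx => (f1 x (a1 x hx)).1
      rw [filter_mem_eq_inter, inter_eq_right.2 hAY]
      refine Eq.trans ?_ a2
      exact sum_congr rfl fun x hx => by rw [(f1 x (a1 x hx)).2]
  · have : ((range (n + 1)).biUnion Q).card ≤ (n + 1) * k := by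
      simpa using card_biUnion_le_card_mul (range (n + 1)) Q k (fun i _ => hQ1 i)
    calc (((range (n + 1)).biUnion Q).card : ℝ) ≤ (n + 1) * k := by exact_mod_cast this
      _ ≤ _ := by gcongr

end TQ

namespace TQ
open Finset Filter Topology

lemma upper_simple (n : ℕ) (hn : 1 ≤ n) :
    ∃ Q : Finset (Finset (Fin n)), AchievesProlixity Q 0 ∧
      (Q.card : ℝ) ≤ (5/4) ^ n * (n + 1) ^ (14 * (Nat.sqrt n + 1)) := by
  set K := Nat.sqrt n + 1 with hK
  have hK1 : 1 ≤ K := by omega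
  have hKn : K ≤ n + 1 := by have := Nat.sqrt_le_self n; omega
  obtain ⟨Q, hQ, hc⟩ := upper n K hK1 (Nat.sqrt_lt.1 (by omega)).le
  refine ⟨Q, hQ, hc.trans ?_⟩
  have hn1 : (2:ℝ) ≤ n + 1 := by
    have : (1:ℝ) ≤ n := by exact_mod_cast hn
    linarith
  set N : ℝ := n + 1 with hN
  have hKN : (K:ℝ) ≤ N := by rw [hN]; exact_mod_cast hKn
  have hR1 : (1:ℝ) ≤ (5/4) ^ n * (4 ^ (4 * K) * N ^ (2 * K)) := by
    have h1 : (1:ℝ) ≤ (5/4) ^ n := one_le_pow₀ (by norm_num)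
    have h2 : (1:ℝ) ≤ 4 ^ (4 * K) := one_le_pow₀ (by norm_num)
    have h3 : (1:ℝ) ≤ N ^ (2 * K) := one_le_pow₀ (by linarith)
    exact one_le_mul_of_one_le_of_one_le h1 (one_le_mul_of_one_le_of_one_le h2 h3)
  have hN0 : 0 ≤ N := by linarith
  have h4 : (4:ℝ) ^ (4 * K) ≤ N ^ (8 * K) := by
    calc (4:ℝ) ^ (4 * K) = 2 ^ (8 * K) := by
          rw [show (4:ℝ) = 2 ^ 2 by norm_num, ← pow_mul]; congr 1; ring
      _ ≤ _ := by gcongr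
  have h5 : (2 * K * n + 1 : ℝ) + 1 ≤ N ^ 3 := by
    have : (n:ℝ) = N - 1 := by rw [hN]; ring
    rw [this]
    have hk1 : (1:ℝ) ≤ K := by exact_mod_cast hK1
    nlinarith [mul_le_mul_of_nonneg_right hKN (by linarith : 0 ≤ N - 1), sq_nonneg N, mul_nonneg hN0 (sq_nonneg (N-1)), sq_nonneg (N-2), mul_nonneg hN0 (by linarith : 0 ≤ N - 2)]
  calc N * ((5/4) ^ n * (4 ^ (4 * K) * N ^ (2 * K)) * (2 * K * n + 1) + 1)
      ≤ N * ((5/4) ^ n * (4 ^ (4 * K) * N ^ (2 * K)) * (2 * K * n + 1) +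
          (5/4) ^ n * (4 ^ (4 * K) * N ^ (2 * K))) := by gcongr
    _ = N * ((5/4) ^ n * (4 ^ (4 * K) * N ^ (2 * K)) * ((2 * K * n + 1) + 1)) := by ring
    _ ≤ N * ((5/4) ^ n * (N ^ (8 * K) * N ^ (2 * K)) * N ^ 3) := by gcongr
    _ = (5/4) ^ n * N ^ (8 * K + 2 * K + 4) := by rw [pow_add, pow_add]; ring
    _ ≤ _ := by
        gcongr
        · linarith
        · omega

lemma uOpt_spec (n : ℕ) (hn : 1 ≤ n) :
    ∃ Q : Finset (Finset (Fin n)), Q.card = uOpt n 0 ∧ AchievesProlixity Q 0 := by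
  obtain ⟨Q, hQ, -⟩ := upper_simple n hn
  have hne : { k | ∃ Q : Finset (Finset (Fin n)), Q.card = k ∧ AchievesProlixity Q 0 }.Nonempty :=
    ⟨_, Q, rfl, hQ⟩
  exact Nat.sInf_mem hne

lemma uOpt_upper (n : ℕ) (hn : 1 ≤ n) :
    (uOpt n 0 : ℝ) ≤ (5/4) ^ n * (n + 1) ^ (14 * (Nat.sqrt n + 1)) := by
  obtain ⟨Q, hQ, hc⟩ := upper_simple n hn
  refine le_trans ?_ hc
  have : uOpt n 0 ≤ Q.card := Nat.sInf_le ⟨Q, rfl, hQ⟩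
  exact_mod_cast this

lemma err_tendsto : Tendsto (fun n : ℕ => 28 * (Real.logb 2 (n + 1) / Real.sqrt n)) atTop (𝓝 0) := by
  have h1 : Tendsto (fun x : ℝ => Real.log x / x ^ (1/2 : ℝ)) atTop (𝓝 0) :=
    (isLittleO_log_rpow_atTop (by norm_num : (0:ℝ) < 1/2)).tendsto_div_nhds_zero
  have h2 : Tendsto (fun n : ℕ => (n : ℝ) + 1) atTop atTop :=
    tendsto_atTop_add_const_right _ _ tendsto_natCast_atTop_atTop
  have h3 := h1.comp h2
  have h4 : Tendsto (fun n : ℕ => (28 * Real.sqrt 2 / Real.log 2) *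
      (Real.log (n + 1) / ((n:ℝ) + 1) ^ (1/2 : ℝ))) atTop (𝓝 0) := by
    simpa using h3.const_mul (28 * Real.sqrt 2 / Real.log 2)
  have hl2 : 0 < Real.log 2 := Real.log_pos (by norm_num)
  refine squeeze_zero' ?_ ?_ h4
  · filter_upwards with n
    have : 0 ≤ Real.logb 2 ((n:ℝ) + 1) := Real.logb_nonneg (by norm_num) (by simp)
    positivity
  · filter_upwards [eventually_ge_atTop 1] with n hn
    have hn' : (1:ℝ) ≤ n := by exact_mod_cast hn
    have hlog : 0 ≤ Real.log ((n:ℝ) + 1) := Real.log_nonneg (by linarith)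
    rw [← Real.sqrt_eq_rpow, Real.logb]
    have hs : Real.sqrt (n + 1) ≤ Real.sqrt 2 * Real.sqrt n := by
      rw [← Real.sqrt_mul (by norm_num)]
      exact Real.sqrt_le_sqrt (by linarith)
    have hsn : 0 < Real.sqrt n := Real.sqrt_pos.2 (by linarith)
    have hsn1 : 0 < Real.sqrt ((n:ℝ) + 1) := Real.sqrt_pos.2 (by linarith)
    have key : 1 / Real.sqrt n ≤ Real.sqrt 2 / Real.sqrt (n + 1) := by
      rw [div_le_div_iff₀ hsn hsn1]; linarith
    calc 28 * (Real.log (n + 1) / Real.log 2 / Real.sqrt n)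
        = 28 * (Real.log (n + 1) / Real.log 2) * (1 / Real.sqrt n) := by ring
      _ ≤ 28 * (Real.log (n + 1) / Real.log 2) * (Real.sqrt 2 / Real.sqrt (n + 1)) := by gcongr
      _ = _ := by ring

lemma upper_log (n : ℕ) (hn : 1 ≤ n) : Real.logb 2 (uOpt n 0 : ℝ) / n ≤
    Real.logb 2 (5/4) + 28 * (Real.logb 2 (n + 1) / Real.sqrt n) := by
  have hn' : (1:ℝ) ≤ n := by exact_mod_cast hn
  have hlog : 0 ≤ Real.logb 2 ((n:ℝ) + 1) := Real.logb_nonneg (by norm_num) (by linarith)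
  have hsn : 1 ≤ Real.sqrt n := by rw [Real.one_le_sqrt]; exact hn'
  have hss : Real.sqrt n * Real.sqrt n = n := Real.mul_self_sqrt (by linarith)
  rcases Nat.eq_zero_or_pos (uOpt n 0) with h0 | h0
  · rw [h0]
    have : 0 ≤ Real.logb 2 (5/4) := Real.logb_nonneg (by norm_num) (by norm_num)
    simp; positivity
  · have h1 : Real.logb 2 (uOpt n 0 : ℝ) ≤
        Real.logb 2 ((5/4) ^ n * (n + 1) ^ (14 * (Nat.sqrt n + 1))) :=
      Real.logb_le_logb_of_le (by norm_num) (by exact_mod_cast h0) (uOpt_upper n hn)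
    rw [Real.logb_mul (by positivity) (by positivity), Real.logb_pow, Real.logb_pow] at h1
    rw [div_le_iff₀ (by linarith)]
    have h2 : ((14 * (Nat.sqrt n + 1) : ℕ) : ℝ) ≤ 28 * Real.sqrt n := by
      push_cast
      have : (Nat.sqrt n : ℝ) ≤ Real.sqrt n := Real.nat_sqrt_le_real_sqrt
      linarith
    calc _ ≤ _ := h1
      _ ≤ n * Real.logb 2 (5/4) + 28 * Real.sqrt n * Real.logb 2 (n + 1) := by gcongr
      _ = _ := by
          rw [add_mul]
          congr 1
          · ring
          · field_simp
            rw [sq, hss, mul_comm]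

lemma lower_log (n k : ℕ) (hn : n = 5 * 2 ^ k) :
    Real.logb 2 (5/4) - 28 * (Real.logb 2 (n + 1) / Real.sqrt n) ≤ Real.logb 2 (uOpt n 0 : ℝ) / n := by
  have hn1 : 1 ≤ n := by have : 1 ≤ 2 ^ k := Nat.one_le_two_pow
                         omega
  have hn' : (1:ℝ) ≤ n := by exact_mod_cast hn1
  obtain ⟨Q, hQc, hQ⟩ := uOpt_spec n hn1
  have h := lower hn Q hQ
  rw [hQc] at h
  have hpos : 0 < (uOpt n 0 : ℝ) := by
    rcases Nat.eq_zero_or_pos (uOpt n 0) with h0 | h0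
    · rw [h0] at h
      have : (0:ℝ) < (5/4) ^ n := by positivity
      simp at h; linarith
    · exact_mod_cast h0
  have h1 : Real.logb 2 ((5/4) ^ n) ≤ Real.logb 2 (2 * (n + 1) * uOpt n 0) :=
    Real.logb_le_logb_of_le (by norm_num) (by positivity) h
  rw [Real.logb_pow, Real.logb_mul (by positivity) (by positivity),
    Real.logb_mul (by positivity) (by positivity)] at h1
  have h2 : Real.logb 2 2 ≤ Real.logb 2 (n + 1) :=
    Real.logb_le_logb_of_le (by norm_num) (by norm_num) (by linarith)
  have hlog : 0 ≤ Real.logb 2 ((n:ℝ) + 1) := Real.logb_nonneg (by norm_num) (by linarith)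
  have hsn : 1 ≤ Real.sqrt n := by rw [Real.one_le_sqrt]; exact hn'
  have hss : Real.sqrt n * Real.sqrt n = n := Real.mul_self_sqrt (by linarith)
  rw [le_div_iff₀ (by linarith), sub_mul]
  have h3 : 28 * (Real.logb 2 (n + 1) / Real.sqrt n) * n = 28 * Real.sqrt n * Real.logb 2 (n + 1) := by
    field_simp
    rw [sq, hss, mul_comm]
  rw [h3]
  nlinarith

end TQ

open TQ in
/-- `limsup_{n→∞} log₂(u_Opt(n,0))/n = log₂(5/4)`. -/
theorem uOpt_zero_limsup :
    Filter.limsup (fun n : ℕ => Real.logb 2 ((uOpt n 0 : ℕ) : ℝ) / (n : ℝ)) Filter.atTop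
      = Real.logb 2 (5 / 4) := by
  have hev : ∀ ε : ℝ, 0 < ε → ∀ᶠ n : ℕ in Filter.atTop,
      28 * (Real.logb 2 (n + 1) / Real.sqrt n) < ε := fun ε hε =>
    err_tendsto.eventually (gt_mem_nhds hε)
  have hup : ∀ ε : ℝ, 0 < ε → ∀ᶠ n : ℕ in Filter.atTop,
      Real.logb 2 ((uOpt n 0 : ℕ) : ℝ) / (n : ℝ) ≤ Real.logb 2 (5 / 4) + ε := by
    intro ε hε
    filter_upwards [hev ε hε, Filter.eventually_ge_atTop 1] with n h1 h2
    linarith [upper_log n h2]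
  have hnn : ∀ n : ℕ, 0 ≤ Real.logb 2 ((uOpt n 0 : ℕ) : ℝ) / (n : ℝ) := by
    intro n
    apply div_nonneg _ (Nat.cast_nonneg _)
    rcases Nat.eq_zero_or_pos (uOpt n 0) with h0 | h0
    · rw [h0]; simp
    · exact Real.logb_nonneg (by norm_num) (by exact_mod_cast h0)
  have hbdd : Filter.IsBoundedUnder (· ≤ ·) Filter.atTop
      (fun n : ℕ => Real.logb 2 ((uOpt n 0 : ℕ) : ℝ) / (n : ℝ)) :=
    ⟨_, Filter.eventually_map.2 (hup 1 one_pos)⟩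
  have hcob : Filter.IsCoboundedUnder (· ≤ ·) Filter.atTop
      (fun n : ℕ => Real.logb 2 ((uOpt n 0 : ℕ) : ℝ) / (n : ℝ)) :=
    Filter.isCoboundedUnder_le_of_le Filter.atTop hnn
  apply le_antisymm
  · apply le_of_forall_pos_le_add
    intro ε hε
    exact Filter.limsup_le_of_le hcob (hup ε hε)
  · apply le_of_forall_pos_sub_le
    intro ε hε
    apply Filter.le_limsup_of_frequently_le _ hbdd
    have hsub : Filter.Tendsto (fun k : ℕ => 5 * 2 ^ k) Filter.atTop Filter.atTop := by
      apply Filter.tendsto_atTop_mono (f := fun k : ℕ => k) _ Filter.tendsto_id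
      intro k
      have := Nat.lt_two_pow_self (n := k)
      omega
    have hfr : ∃ᶠ k : ℕ in Filter.atTop, Real.logb 2 (5 / 4) - ε ≤
        Real.logb 2 ((uOpt (5 * 2 ^ k) 0 : ℕ) : ℝ) / ((5 * 2 ^ k : ℕ) : ℝ) := by
      apply Filter.Eventually.frequently
      filter_upwards [hsub.eventually (hev ε hε)] with k hk
      linarith [lower_log (5 * 2 ^ k) k rfl]
    exact hsub.frequently hfr
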